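/- Suppose F̄ is continuously differentiable with everywhere positive values and continuous density f = −F̄′, the hazard rate f/F̄ and the SERPT rank function r_S are piecewise monotonic, and [0,∞) decomposes into a locally finite collection of maximal hills and valleys for each of the SERPT rank function r_S and the Gittins rank function r_G. Let y_S, z_S (resp. y_G, z_G) be the previous/next hill age functions of r_S (resp. r_G). Then, as an inequality of (possibly infinite) Lebesgue integrals, ∫₀^∞ J(z_S(x))/(h(y_S(x))·h(z_S(x))) · f(x) dx ≤ (2/(1 + √(1−ρ))) · ∫₀^∞ J(z_G(x))/(h(y_G(x))·h(z_G(x))) · f(x) dx. -/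

import Mathlib

open MeasureTheory Set

/-- Increasing envelope of a rank function: `R(a) = sup_{0 ≤ b ≤ a} r(b)`. -/
noncomputable def incEnvelope (r : ℝ → ℝ) (a : ℝ) : ℝ := sSup (r '' Icc 0 a)

/-- An age `a > 0` is a valley age of `r` if the increasing envelope of `r` is
locally constant around `a`. -/
def IsValleyAge (r : ℝ → ℝ) (a : ℝ) : Prop :=
  0 < a ∧ ∃ ε > 0, ∀ b ∈ Ioo (a - ε) (a + ε), incEnvelope r b = incEnvelope r a

/-- A hill age is a nonnegative age that is not a valley age (`0` is always a hill age). -/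
def IsHillAge (r : ℝ → ℝ) (a : ℝ) : Prop := 0 ≤ a ∧ ¬ IsValleyAge r a

/-- Previous hill age `y(x) = sup {a < x : a hill age}` (equals `0` when `x = 0`). -/
noncomputable def prevHill (r : ℝ → ℝ) (x : ℝ) : ℝ := sSup {a | a < x ∧ IsHillAge r a}

-- Next hill age, valued in `WithTop ℝ`: `z(x) = inf {a ≥ x : a hill age}`, and `∞`
-- if there is no hill age `≥ x`.
open Classical in
noncomputable def nextHillT (r : ℝ → ℝ) (x : ℝ) : WithTop ℝ :=
  if ∃ a, x ≤ a ∧ IsHillAge r a then ((sInf {a | x ≤ a ∧ IsHillAge r a} : ℝ) : WithTop ℝ)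
  else ⊤

/-- Next hill age as a real number (used for finite decompositions). -/
noncomputable def nextHill (r : ℝ → ℝ) (x : ℝ) : ℝ := sInf {a | x ≤ a ∧ IsHillAge r a}

/-- A hill size is a size `x` with `y(x) = x = z(x)`. -/
def IsHillSize (r : ℝ → ℝ) (x : ℝ) : Prop := prevHill r x = x ∧ nextHill r x = x

/-- SERPT rank function: `r_S(a) = (∫_a^∞ F̄)/F̄(a)`. -/
noncomputable def serptRank (F : ℝ → ℝ) (a : ℝ) : ℝ := (∫ t in Ioi a, F t) / F a

/-- Efficiency function `η(a,b) = (∫_a^b F̄)/(F̄(a) − F̄(b))`. -/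
noncomputable def effFn (F : ℝ → ℝ) (a b : ℝ) : ℝ := (∫ t in a..b, F t) / (F a - F b)

/-- Gittins rank function: `r_G(a) = inf {η(a,b) : b ∈ (a,∞], F̄(b) < F̄(a)}`,
where the choice `b = ∞` gives `η(a,∞) = r_S(a)`. -/
noncomputable def gittinsRank (F : ℝ → ℝ) (a : ℝ) : ℝ :=
  sInf (insert (serptRank F a) {x | ∃ b, a < b ∧ F b < F a ∧ x = effFn F a b})

/-- Truncated load complement `h(a) = 1 − λ∫₀^a F̄`, with `h(∞) = 1 − ρ`. -/
noncomputable def loadCompT (F : ℝ → ℝ) (lam : ℝ) : WithTop ℝ → ℝ :=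
  WithTop.recTopCoe (1 - lam * ∫ t in Ioi (0:ℝ), F t)
    (fun a => 1 - lam * ∫ t in (0:ℝ)..a, F t)

/-- Truncated second-moment factor `J(a) = λ∫₀^a t·F̄(t) dt`, with
`J(∞) = λ∫₀^∞ t·F̄(t) dt = (λ/2)E[X²]`. -/
noncomputable def secMomT (F : ℝ → ℝ) (lam : ℝ) : WithTop ℝ → ℝ :=
  WithTop.recTopCoe (lam * ∫ t in Ioi (0:ℝ), t * F t)
    (fun a => lam * ∫ t in (0:ℝ)..a, t * F t)

/-- A function `g : ℝ → ℝ` is piecewise monotonic: every compact interval admits a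
finite partition on whose pieces `g` is monotone. -/
def PiecewiseMonotone (g : ℝ → ℝ) : Prop :=
  ∀ a b : ℝ, a ≤ b → ∃ (n : ℕ) (p : ℕ → ℝ), p 0 = a ∧ p n = b ∧
    (∀ i < n, p i ≤ p (i + 1)) ∧
    ∀ i < n, MonotoneOn g (Icc (p i) (p (i + 1))) ∨ AntitoneOn g (Icc (p i) (p (i + 1)))

/-- The interval `(u, v]` decomposes into finitely many hills and valleys of `r`. -/
def FiniteHillValleyDecomp (r : ℝ → ℝ) (u v : ℝ) : Prop :=
  ∃ (n : ℕ) (p : ℕ → ℝ), p 0 = u ∧ p n = v ∧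
    (∀ i ≤ n, IsHillAge r (p i)) ∧ (∀ i < n, p i < p (i + 1)) ∧
    ∀ i < n, (∀ x ∈ Ioc (p i) (p (i + 1)), IsHillSize r x) ∨
             (∀ x ∈ Ioo (p i) (p (i + 1)), ¬ IsHillSize r x)

/-- `[0,∞)` decomposes into a locally finite collection of hills and valleys of `r`:
either arbitrarily large prefixes `[0, v]` admit finite hill/valley decompositions,
or some prefix does and everything beyond it is one final (infinite) valley. -/
def LocFinHillValleyDecomp (r : ℝ → ℝ) : Prop :=
  (∀ b : ℝ, ∃ v, b ≤ v ∧ FiniteHillValleyDecomp r 0 v) ∨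
  (∃ v, 0 ≤ v ∧ FiniteHillValleyDecomp r 0 v ∧ ∀ x, v < x → ¬ IsHillAge r x)


section HillAges

variable {r : ℝ → ℝ}

/-- The open interval between a real left end and a possibly infinite right end. -/
def gapSet (a : ℝ) (z : WithTop ℝ) : Set ℝ := {t | a < t ∧ (t : WithTop ℝ) < z}

theorem gapSet_coe (a z : ℝ) : gapSet a z = Ioo a z := by
  ext t; simp [gapSet]

theorem gapSet_top (a : ℝ) : gapSet a ⊤ = Ioi a := by
  ext t; simp [gapSet]

theorem isOpen_gapSet (a : ℝ) (z : WithTop ℝ) : IsOpen (gapSet a z) := by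
  induction z using WithTop.recTopCoe with
  | top => rw [gapSet_top]; exact isOpen_Ioi
  | coe z => rw [gapSet_coe]; exact isOpen_Ioo

theorem isPreconnected_gapSet (a : ℝ) (z : WithTop ℝ) : IsPreconnected (gapSet a z) := by
  induction z using WithTop.recTopCoe with
  | top => rw [gapSet_top]; exact isPreconnected_Ioi
  | coe z => rw [gapSet_coe]; exact isPreconnected_Ioo

theorem isHillAge_zero (r : ℝ → ℝ) : IsHillAge r 0 := ⟨le_rfl, fun h => lt_irrefl _ h.1⟩

theorem isClosed_hillAges (r : ℝ → ℝ) : IsClosed {a | IsHillAge r a} := by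
  have hv : IsOpen {a | IsValleyAge r a} := by
    rw [Metric.isOpen_iff]
    rintro a ⟨ha, ε, hε, h⟩
    refine ⟨min a (ε / 2), by positivity, fun b hb => ?_⟩
    rw [Real.ball_eq_Ioo] at hb
    have h1 := min_le_left a (ε / 2)
    have h2 := min_le_right a (ε / 2)
    refine ⟨by linarith [hb.1], ε / 2, by positivity, fun c hc => ?_⟩
    rw [h c ⟨by linarith [hc.1, hb.1], by linarith [hc.2, hb.2]⟩,
      h b ⟨by linarith [hb.1], by linarith [hb.2]⟩]
  exact isClosed_Ici.inter hv.isClosed_compl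

theorem isHillAge_prevHill {x : ℝ} (hx : 0 < x) : IsHillAge r (prevHill r x) := by
  have hcl := (isClosed_hillAges r).closure_subset_iff.2
    (fun a (ha : a ∈ {a | a < x ∧ IsHillAge r a}) => ha.2)
  exact hcl (csSup_mem_closure ⟨0, hx, isHillAge_zero r⟩ ⟨x, fun a ha => ha.1.le⟩)

theorem prevHill_le {x : ℝ} (hx : 0 < x) : prevHill r x ≤ x :=
  csSup_le ⟨0, hx, isHillAge_zero r⟩ fun _ ha => ha.1.le

theorem le_prevHill {x a : ℝ} (hax : a < x) (ha : IsHillAge r a) : a ≤ prevHill r x :=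
  le_csSup ⟨x, fun _ hb => hb.1.le⟩ ⟨hax, ha⟩

theorem nextHillT_of_exists {x : ℝ} (h : ∃ a, x ≤ a ∧ IsHillAge r a) :
    nextHillT r x = (sInf {a | x ≤ a ∧ IsHillAge r a} : ℝ) := by
  rw [nextHillT, if_pos h]

theorem nextHillT_le {x a : ℝ} (hxa : x ≤ a) (ha : IsHillAge r a) : nextHillT r x ≤ a := by
  rw [nextHillT_of_exists ⟨a, hxa, ha⟩]
  exact WithTop.coe_le_coe.2 (csInf_le ⟨x, fun _ hb => hb.1⟩ ⟨hxa, ha⟩)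

theorem le_nextHillT (r : ℝ → ℝ) (x : ℝ) : (x : WithTop ℝ) ≤ nextHillT r x := by
  by_cases h : ∃ a, x ≤ a ∧ IsHillAge r a
  · rw [nextHillT_of_exists h]
    exact WithTop.coe_le_coe.2 (le_csInf h fun _ hb => hb.1)
  · rw [nextHillT, if_neg h]; exact le_top

theorem isHillAge_of_nextHillT_eq {x z : ℝ} (h : nextHillT r x = z) : IsHillAge r z := by
  by_cases h' : ∃ a, x ≤ a ∧ IsHillAge r a
  · rw [nextHillT_of_exists h', WithTop.coe_eq_coe] at h
    have hcl := (isClosed_hillAges r).closure_subset_iff.2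
      (fun a (ha : a ∈ {a | x ≤ a ∧ IsHillAge r a}) => ha.2)
    rw [← h]
    exact hcl (csInf_mem_closure h' ⟨x, fun _ hb => hb.1⟩)
  · rw [nextHillT, if_neg h'] at h
    exact absurd h WithTop.top_ne_coe

theorem nextHillT_of_isHillAge {x : ℝ} (hx : IsHillAge r x) : nextHillT r x = x :=
  le_antisymm (nextHillT_le le_rfl hx) (le_nextHillT r x)

theorem not_isHillAge_of_mem_gap {x t : ℝ} (hx : ¬ IsHillAge r x)
    (ht : t ∈ gapSet (prevHill r x) (nextHillT r x)) : ¬ IsHillAge r t := by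
  intro h
  rcases lt_trichotomy t x with htx | rfl | htx
  · exact absurd (le_prevHill htx h) (not_le.2 ht.1)
  · exact hx h
  · exact absurd (nextHillT_le htx.le h) (not_le.2 ht.2)

theorem prevHill_lt {x : ℝ} (hx : 0 < x) (h : ¬ IsHillAge r x) : prevHill r x < x :=
  lt_of_le_of_ne (prevHill_le hx) fun he => h (he ▸ isHillAge_prevHill hx)

theorem lt_nextHillT {x : ℝ} (h : ¬ IsHillAge r x) : (x : WithTop ℝ) < nextHillT r x :=
  lt_of_le_of_ne (le_nextHillT r x) fun he => h (isHillAge_of_nextHillT_eq he.symm)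

theorem prevHill_nonneg {x : ℝ} (hx : 0 < x) : 0 ≤ prevHill r x := (isHillAge_prevHill hx).1

theorem mem_gap_of_between {a x y t : ℝ} {z : WithTop ℝ} (hx : x ∈ gapSet a z)
    (hy : y ∈ gapSet a z) (hxt : x ≤ t) (hty : t ≤ y) : t ∈ gapSet a z :=
  ⟨hx.1.trans_le hxt, (WithTop.coe_le_coe.2 hty).trans_lt hy.2⟩

/-- Two points in an interval free of hill ages have the same previous and next hill ages. -/
theorem hills_eq_of_gap {a : ℝ} {z : WithTop ℝ} (h : ∀ t ∈ gapSet a z, ¬ IsHillAge r t)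
    {x y : ℝ} (hx : x ∈ gapSet a z) (hy : y ∈ gapSet a z) :
    prevHill r x = prevHill r y ∧ nextHillT r x = nextHillT r y := by
  wlog hxy : x ≤ y generalizing x y
  · exact (this hy hx (le_of_not_ge hxy)).imp Eq.symm Eq.symm
  have h1 : {b | b < x ∧ IsHillAge r b} = {b | b < y ∧ IsHillAge r b} := by
    ext b
    refine ⟨fun hb => ⟨hb.1.trans_le hxy, hb.2⟩, fun hb => ⟨?_, hb.2⟩⟩
    by_contra hxb
    exact h b (mem_gap_of_between hx hy (not_lt.1 hxb) hb.1.le) hb.2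
  have h2 : ∀ b, (x ≤ b ∧ IsHillAge r b) ↔ (y ≤ b ∧ IsHillAge r b) := by
    intro b
    refine ⟨fun hb => ⟨?_, hb.2⟩, fun hb => ⟨hxy.trans hb.1, hb.2⟩⟩
    by_contra hyb
    exact h b (mem_gap_of_between hx hy hb.1 (not_le.1 hyb).le) hb.2
  refine ⟨by rw [prevHill, h1, prevHill], ?_⟩
  have h3 : {b | x ≤ b ∧ IsHillAge r b} = {b | y ≤ b ∧ IsHillAge r b} := Set.ext h2
  by_cases hb : ∃ b, x ≤ b ∧ IsHillAge r b
  · rw [nextHillT_of_exists hb, nextHillT_of_exists (hb.imp fun b => (h2 b).1), h3]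
  · rw [nextHillT, if_neg hb, nextHillT, if_neg fun ⟨b, h⟩ => hb ⟨b, (h2 b).2 h⟩]

theorem incEnvelope_eq_of_gap {a : ℝ} {z : WithTop ℝ} (ha : 0 ≤ a)
    (h : ∀ t ∈ gapSet a z, ¬ IsHillAge r t)
    {x y : ℝ} (hx : x ∈ gapSet a z) (hy : y ∈ gapSet a z) :
    incEnvelope r x = incEnvelope r y := by
  have key : ∀ t ∈ gapSet a z, HasDerivAt (incEnvelope r) 0 t := by
    intro t ht
    have hv : IsValleyAge r t := by
      by_contra hv
      exact h t ht ⟨ha.trans ht.1.le, hv⟩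
    obtain ⟨-, ε, hε, hc⟩ := hv
    refine (hasDerivAt_const t (incEnvelope r t)).congr_of_eventuallyEq ?_
    filter_upwards [Ioo_mem_nhds (by linarith : t - ε < t) (by linarith : t < t + ε)] with b hb
    exact hc b hb
  exact (isOpen_gapSet a z).is_const_of_deriv_eq_zero (isPreconnected_gapSet a z)
    (fun t ht => (key t ht).differentiableAt.differentiableWithinAt)
    (fun t ht => (key t ht).deriv) hx hy

/-- Integrals over `(0, ∞)` compare if they do so on every valley and pointwise on hills. -/
theorem lintegral_le_of_gaps {φ ψ : ℝ → ENNReal}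
    (hhill : ∀ x, 0 < x → IsHillAge r x → prevHill r x = x → φ x ≤ ψ x)
    (hgap : ∀ x, 0 < x → ¬ IsHillAge r x →
      ∫⁻ t in gapSet (prevHill r x) (nextHillT r x), φ t ≤
        ∫⁻ t in gapSet (prevHill r x) (nextHillT r x), ψ t) :
    ∫⁻ x in Ioi (0 : ℝ), φ x ≤ ∫⁻ x in Ioi (0 : ℝ), ψ x := by
  set H : Set ℝ := {a | IsHillAge r a} with hH
  have hHm : MeasurableSet H := (isClosed_hillAges r).measurableSet
  set s : ℝ → Set ℝ := fun a => {t | 0 < t ∧ ¬ IsHillAge r t ∧ prevHill r t = a} with hs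
  have hs_eq : ∀ x, 0 < x → ¬ IsHillAge r x →
      s (prevHill r x) = gapSet (prevHill r x) (nextHillT r x) := by
    intro x hx hxv
    have hxg : x ∈ gapSet (prevHill r x) (nextHillT r x) := ⟨prevHill_lt hx hxv, lt_nextHillT hxv⟩
    ext t
    constructor
    · rintro ⟨ht, htv, he⟩
      refine ⟨he ▸ prevHill_lt ht htv, ?_⟩
      by_contra hlt
      have hle := not_lt.1 hlt
      obtain ⟨z, hz⟩ := WithTop.ne_top_iff_exists.1
        (ne_top_of_le_ne_top WithTop.coe_ne_top hle)
      rw [← hz, WithTop.coe_le_coe] at hle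
      have hzh : IsHillAge r z := isHillAge_of_nextHillT_eq hz.symm
      have hxz : x < z := by
        have := lt_nextHillT hxv
        rwa [← hz, WithTop.coe_lt_coe] at this
      have hzt : z < t := lt_of_le_of_ne hle fun h => htv (h ▸ hzh)
      have := le_prevHill hzt hzh
      linarith [prevHill_lt hx hxv]
    · intro ht
      have := hills_eq_of_gap (fun _ => not_isHillAge_of_mem_gap hxv) ht hxg
      exact ⟨(prevHill_nonneg hx).trans_lt ht.1, not_isHillAge_of_mem_gap hxv ht, this.1⟩
  set T : Set ℝ := prevHill r '' (Ioi 0 \ H) with hT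
  have hsT : ∀ a ∈ T, ∃ x, 0 < x ∧ ¬ IsHillAge r x ∧ a = prevHill r x ∧
      s a = gapSet (prevHill r x) (nextHillT r x) := by
    rintro a ⟨x, ⟨hx, hxv⟩, rfl⟩
    exact ⟨x, hx, hxv, rfl, hs_eq x hx hxv⟩
  have hdisj : T.PairwiseDisjoint s := by
    intro a _ b _ hab
    exact Set.disjoint_left.2 fun t hta htb => hab (hta.2.2.symm.trans htb.2.2)
  have hopen : ∀ a ∈ T, IsOpen (s a) := by
    intro a ha
    obtain ⟨x, -, -, -, h⟩ := hsT a ha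
    rw [h]; exact isOpen_gapSet _ _
  have hTc : T.Countable := by
    refine hdisj.countable_of_isOpen hopen ?_
    rintro a ⟨x, ⟨hx, hxv⟩, rfl⟩
    exact ⟨x, hx, hxv, rfl⟩
  have hU : Ioi (0 : ℝ) \ H = ⋃ a ∈ T, s a := by
    ext t
    simp only [mem_iUnion, exists_prop]
    constructor
    · rintro ht
      exact ⟨prevHill r t, ⟨t, ht, rfl⟩, ht.1, ht.2, rfl⟩
    · rintro ⟨a, -, ht, htv, -⟩
      exact ⟨ht, htv⟩
  have hvalley : ∫⁻ x in Ioi (0 : ℝ) \ H, φ x ≤ ∫⁻ x in Ioi (0 : ℝ) \ H, ψ x := by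
    rw [hU, lintegral_biUnion hTc (fun a ha => (hopen a ha).measurableSet) hdisj,
      lintegral_biUnion hTc (fun a ha => (hopen a ha).measurableSet) hdisj]
    refine ENNReal.tsum_le_tsum fun ⟨a, ha⟩ => ?_
    obtain ⟨x, hx, hxv, -, h⟩ := hsT a ha
    simp only [h]
    exact hgap x hx hxv
  set E : Set ℝ := {x | 0 < x ∧ IsHillAge r x ∧ prevHill r x < x} with hE
  have hEc : E.Countable := by
    have hd : E.PairwiseDisjoint fun x => Ioo (prevHill r x) x := by
      have aux : ∀ x ∈ E, ∀ y ∈ E, x < y →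
          Disjoint (Ioo (prevHill r x) x) (Ioo (prevHill r y) y) := by
        intro x hx y hy hxy
        refine Set.disjoint_left.2 fun t ht ht' => ?_
        linarith [ht.2, ht'.1, le_prevHill hxy hx.2.1]
      intro x hx y hy hxy
      rcases lt_or_gt_of_ne hxy with h | h
      · exact aux x hx y hy h
      · exact (aux y hy x hx h).symm
    exact hd.countable_of_isOpen (fun _ _ => isOpen_Ioo) fun x hx => nonempty_Ioo.2 hx.2.2
  have hhills : ∫⁻ x in Ioi (0 : ℝ) ∩ H, φ x ≤ ∫⁻ x in Ioi (0 : ℝ) ∩ H, ψ x := by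
    refine lintegral_mono_ae ?_
    have hnE : ∀ᵐ x ∂(volume.restrict (Ioi (0 : ℝ) ∩ H)), x ∉ E :=
      ae_restrict_of_ae ((measure_eq_zero_iff_ae_notMem).1 (hEc.measure_zero volume))
    filter_upwards [hnE, ae_restrict_mem (measurableSet_Ioi.inter hHm)] with x hxE hx
    refine hhill x hx.1 hx.2 (le_antisymm (prevHill_le hx.1) ?_)
    by_contra hlt
    exact hxE ⟨hx.1, hx.2, not_le.1 hlt⟩
  rw [← lintegral_inter_add_sdiff φ (Ioi 0) hHm, ← lintegral_inter_add_sdiff ψ (Ioi 0) hHm]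
  exact add_le_add hhills hvalley

end HillAges

section ContinuousRank

variable {r : ℝ → ℝ}

theorem incEnvelope_eq_of_isMax {s t : ℝ} (hs : s ∈ Icc 0 t) (h : ∀ b ∈ Icc 0 t, r b ≤ r s) :
    incEnvelope r t = r s :=
  IsGreatest.csSup_eq ⟨⟨s, hs, rfl⟩, by rintro _ ⟨b, hb, rfl⟩; exact h b hb⟩

theorem exists_incEnvelope_eq (hr : Continuous r) {t : ℝ} (ht : 0 ≤ t) :
    ∃ s ∈ Icc 0 t, (∀ b ∈ Icc 0 t, r b ≤ r s) ∧ incEnvelope r t = r s := by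
  obtain ⟨s, hs, hmax⟩ := isCompact_Icc.exists_isMaxOn (nonempty_Icc.2 ht) hr.continuousOn
  exact ⟨s, hs, fun b hb => hmax hb, incEnvelope_eq_of_isMax hs fun b hb => hmax hb⟩

theorem le_of_isHillAge (hr : Continuous r) {x b : ℝ} (hx : IsHillAge r x)
    (hb : 0 ≤ b) (hbx : b ≤ x) : r b ≤ r x := by
  by_contra! hlt
  obtain ⟨s, hs, hmax, -⟩ := exists_incEnvelope_eq hr hx.1
  have hsx : r x < r s := hlt.trans_le (hmax b ⟨hb, hbx⟩)
  have hsx' : s < x := lt_of_le_of_ne hs.2 (by rintro rfl; exact lt_irrefl _ hsx)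
  obtain ⟨δ, hδ, hball⟩ := Metric.eventually_nhds_iff_ball.1
    (hr.continuousAt.eventually_lt_const hsx)
  refine hx.2 ⟨hs.1.trans_lt hsx', min δ (x - s), lt_min hδ (by linarith), ?_⟩
  have h1 := min_le_left δ (x - s)
  have h2 := min_le_right δ (x - s)
  have key : ∀ t ∈ Ioo (x - min δ (x - s)) (x + min δ (x - s)), incEnvelope r t = r s := by
    intro t ht
    refine incEnvelope_eq_of_isMax ⟨hs.1, by linarith [ht.1]⟩ fun c hc => ?_
    rcases le_or_gt c x with hcx | hcx
    · exact hmax c ⟨hc.1, hcx⟩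
    · refine (hball c ?_).le
      rw [Real.ball_eq_Ioo]
      exact ⟨by linarith, by linarith [hc.2, ht.2]⟩
  intro t ht
  have hm : 0 < min δ (x - s) := lt_min hδ (by linarith)
  rw [key t ht, key x ⟨by linarith, by linarith⟩]

theorem incEnvelope_gap (hr : Continuous r) {x : ℝ} (hx : 0 < x) (hxv : ¬ IsHillAge r x) :
    r (prevHill r x) = incEnvelope r x := by
  set y := prevHill r x with hy
  have hyx : y < x := prevHill_lt hx hxv
  have hy0 : 0 ≤ y := prevHill_nonneg hx
  have hyh : IsHillAge r y := isHillAge_prevHill hx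
  have hle : ∀ b ∈ Icc 0 x, r b ≤ incEnvelope r x := by
    obtain ⟨s, _, hmax, he⟩ := exists_incEnvelope_eq hr hx.le
    rw [he]; exact hmax
  refine le_antisymm (hle y ⟨hy0, hyx.le⟩) ?_
  by_contra! hlt
  obtain ⟨δ, hδ, hball⟩ := Metric.eventually_nhds_iff_ball.1
    (hr.continuousAt.eventually_lt_const hlt)
  set t := y + min (δ / 2) (x - y) with ht
  have hm : 0 < min (δ / 2) (x - y) := lt_min (by positivity) (by linarith)
  have h1 := min_le_left (δ / 2) (x - y)
  have h2 := min_le_right (δ / 2) (x - y)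
  have htg : t ∈ gapSet y (nextHillT r x) :=
    ⟨by linarith, (WithTop.coe_le_coe.2 (by linarith : t ≤ x)).trans_lt (lt_nextHillT hxv)⟩
  have heq := incEnvelope_eq_of_gap hy0 (fun _ => not_isHillAge_of_mem_gap hxv) htg
    ⟨hyx, lt_nextHillT hxv⟩
  obtain ⟨s, hs, -, he⟩ := exists_incEnvelope_eq hr (hy0.trans htg.1.le)
  have : r s < incEnvelope r x := by
    rcases le_or_gt s y with hsy | hsy
    · exact (le_of_isHillAge hr hyh hs.1 hsy).trans_lt hlt
    · refine hball s ?_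
      rw [Real.ball_eq_Ioo]
      exact ⟨by linarith, by linarith [hs.2]⟩
  linarith

/-- A continuous rank function takes the same value at both ends of a bounded valley. -/
theorem rank_eq_of_gap (hr : Continuous r) {x z : ℝ} (hx : 0 < x) (hxv : ¬ IsHillAge r x)
    (hz : nextHillT r x = z) : r z = r (prevHill r x) := by
  have hxz : x < z := by
    have := lt_nextHillT hxv
    rwa [hz, WithTop.coe_lt_coe] at this
  have hzh : IsHillAge r z := isHillAge_of_nextHillT_eq hz
  have hyx := prevHill_lt hx hxv
  refine le_antisymm ?_ (le_of_isHillAge hr hzh (prevHill_nonneg hx) (hyx.trans hxz).le)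
  rw [incEnvelope_gap hr hx hxv]
  refine le_of_tendsto (hr.continuousWithinAt (s := Iio z) (x := z)) ?_
  filter_upwards [Ioo_mem_nhdsLT hxz] with t ht
  have heq := incEnvelope_eq_of_gap (prevHill_nonneg hx)
    (fun _ => not_isHillAge_of_mem_gap hxv) (x := t) (y := x)
    ⟨hyx.trans ht.1, by rw [hz]; exact WithTop.coe_lt_coe.2 ht.2⟩ ⟨hyx, lt_nextHillT hxv⟩
  obtain ⟨s, _, hmax, he⟩ := exists_incEnvelope_eq hr (hx.trans ht.1).le
  rw [← heq, he]
  exact hmax t ⟨(hx.trans ht.1).le, le_rfl⟩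

end ContinuousRank

section SmoothTail

/-- A positive, continuously differentiable tail function with finite mean. -/
structure IsSmoothTail (F : ℝ → ℝ) : Prop where
  contDiff : ContDiff ℝ 1 F
  anti : Antitone F
  pos : ∀ t, 0 < F t
  integrableOn : IntegrableOn F (Ioi 0)

/-- The integrated tail `∫_a^∞ F`. -/
noncomputable def tailInt (F : ℝ → ℝ) (a : ℝ) : ℝ := ∫ t in Ioi a, F t

variable {F : ℝ → ℝ}

namespace IsSmoothTail

theorem continuous (hF : IsSmoothTail F) : Continuous F := hF.contDiff.continuous

theorem hasDerivAt (hF : IsSmoothTail F) (t : ℝ) : HasDerivAt F (deriv F t) t :=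
  (hF.contDiff.differentiable one_ne_zero t).hasDerivAt

theorem deriv_nonpos (hF : IsSmoothTail F) (t : ℝ) : deriv F t ≤ 0 := hF.anti.deriv_nonpos

theorem continuous_deriv (hF : IsSmoothTail F) : Continuous (deriv F) :=
  hF.contDiff.continuous_deriv le_rfl

theorem intervalIntegrable (hF : IsSmoothTail F) (a b : ℝ) :
    IntervalIntegrable F volume a b := hF.continuous.intervalIntegrable a b

theorem integrableOn_Ioi (hF : IsSmoothTail F) (a : ℝ) : IntegrableOn F (Ioi a) := by
  refine ((hF.continuous.integrableOn_Ioc (a := a) (b := 0)).union hF.integrableOn).mono_set ?_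
  intro t ht
  rcases le_or_gt t 0 with h | h
  · exact Or.inl ⟨ht, h⟩
  · exact Or.inr h

theorem integral_eq_sub (hF : IsSmoothTail F) (a b : ℝ) :
    ∫ t in a..b, F t = tailInt F a - tailInt F b :=
  (intervalIntegral.integral_Ioi_sub_Ioi' (hF.integrableOn_Ioi a) (hF.integrableOn_Ioi b)).symm

theorem hasDerivAt_tailInt (hF : IsSmoothTail F) (a : ℝ) :
    HasDerivAt (tailInt F) (-F a) a := by
  have h : tailInt F = fun b => tailInt F 0 - ∫ t in (0 : ℝ)..b, F t := by
    funext b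
    rw [hF.integral_eq_sub]; ring
  rw [h]
  exact (intervalIntegral.integral_hasDerivAt_right (hF.intervalIntegrable 0 a)
    (hF.continuous.stronglyMeasurableAtFilter _ _) hF.continuous.continuousAt).const_sub _

theorem continuous_tailInt (hF : IsSmoothTail F) : Continuous (tailInt F) :=
  continuous_iff_continuousAt.2 fun a => (hF.hasDerivAt_tailInt a).continuousAt

theorem strictAnti_tailInt (hF : IsSmoothTail F) : StrictAnti (tailInt F) :=
  strictAnti_of_deriv_neg fun a => by
    rw [(hF.hasDerivAt_tailInt a).deriv]; linarith [hF.pos a]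

theorem tailInt_pos (hF : IsSmoothTail F) (a : ℝ) : 0 < tailInt F a :=
  lt_of_le_of_lt (setIntegral_nonneg measurableSet_Ioi fun t _ => (hF.pos t).le)
    (hF.strictAnti_tailInt (lt_add_one a))

theorem tendsto_tailInt (hF : IsSmoothTail F) :
    Filter.Tendsto (tailInt F) Filter.atTop (nhds 0) := by
  have h := (intervalIntegral_tendsto_integral_Ioi 0 hF.integrableOn Filter.tendsto_id).const_sub
    (tailInt F 0)
  have e : tailInt F 0 - ∫ t in Ioi (0 : ℝ), F t = 0 := sub_self _
  rw [e] at h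
  refine h.congr fun b => ?_
  rw [id, hF.integral_eq_sub]; ring

theorem le_tailInt_pred (hF : IsSmoothTail F) (t : ℝ) : F t ≤ tailInt F (t - 1) := by
  have h1 : ∫ _ in (t - 1)..t, F t ≤ ∫ s in (t - 1)..t, F s :=
    intervalIntegral.integral_mono_on (by linarith) (by simp) (hF.intervalIntegrable _ _)
      fun s hs => hF.anti hs.2
  rw [hF.integral_eq_sub] at h1
  simp only [intervalIntegral.integral_const, smul_eq_mul] at h1
  linarith [hF.tailInt_pos t]

theorem tendsto_zero (hF : IsSmoothTail F) : Filter.Tendsto F Filter.atTop (nhds 0) := by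
  refine squeeze_zero (fun t => (hF.pos t).le) hF.le_tailInt_pred
    (hF.tendsto_tailInt.comp (Filter.tendsto_atTop_add_const_right _ (-1) Filter.tendsto_id))

theorem serptRank_mul (hF : IsSmoothTail F) (a : ℝ) : serptRank F a * F a = tailInt F a :=
  div_mul_cancel₀ _ (hF.pos a).ne'

theorem serptRank_pos (hF : IsSmoothTail F) (a : ℝ) : 0 < serptRank F a :=
  div_pos (hF.tailInt_pos a) (hF.pos a)

theorem continuous_serptRank (hF : IsSmoothTail F) : Continuous (serptRank F) :=
  hF.continuous_tailInt.div hF.continuous fun a => (hF.pos a).ne'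

theorem effFn_eq (hF : IsSmoothTail F) (a b : ℝ) :
    effFn F a b = (tailInt F a - tailInt F b) / (F a - F b) := by
  rw [effFn, hF.integral_eq_sub]

theorem gittinsRank_lowerBound (hF : IsSmoothTail F) (a : ℝ) :
    0 ∈ lowerBounds (insert (serptRank F a) {x | ∃ b, a < b ∧ F b < F a ∧ x = effFn F a b}) := by
  rintro _ (rfl | ⟨b, hab, hb, rfl⟩)
  · exact (hF.serptRank_pos a).le
  · rw [hF.effFn_eq]
    exact div_nonneg (by linarith [hF.strictAnti_tailInt hab]) (by linarith)

theorem gittinsRank_le_serptRank (hF : IsSmoothTail F) (a : ℝ) :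
    gittinsRank F a ≤ serptRank F a :=
  csInf_le ⟨0, hF.gittinsRank_lowerBound a⟩ (mem_insert _ _)

theorem gittinsRank_mul_le (hF : IsSmoothTail F) {a b : ℝ} (hab : a ≤ b) :
    gittinsRank F a * (F a - F b) ≤ tailInt F a - tailInt F b := by
  rcases (hF.anti hab).lt_or_eq with hb | hb
  · have hab' : a < b := lt_of_le_of_ne hab (by rintro rfl; exact lt_irrefl _ hb)
    rw [← le_div_iff₀ (by linarith), ← hF.effFn_eq]
    exact csInf_le ⟨0, hF.gittinsRank_lowerBound a⟩ (mem_insert_of_mem _ ⟨b, hab', hb, rfl⟩)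
  · rw [hb]
    linarith [hF.strictAnti_tailInt.antitone hab]

theorem le_gittinsRank (hF : IsSmoothTail F) {a c : ℝ} (h : c ≤ serptRank F a)
    (h' : ∀ b, a < b → c * (F a - F b) ≤ tailInt F a - tailInt F b) : c ≤ gittinsRank F a := by
  refine le_csInf ⟨_, mem_insert _ _⟩ ?_
  rintro _ (rfl | ⟨b, hab, hb, rfl⟩)
  · exact h
  · rw [hF.effFn_eq, le_div_iff₀ (by linarith)]
    exact h' b hab

theorem gittinsRank_le_of_serptRank_le (hF : IsSmoothTail F) {s b : ℝ} (hsb : s ≤ b)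
    (h : ∀ d ∈ Icc s b, serptRank F d ≤ serptRank F s) :
    gittinsRank F b ≤ gittinsRank F s := by
  have hb : gittinsRank F b ≤ serptRank F s :=
    (hF.gittinsRank_le_serptRank b).trans (h b ⟨hsb, le_rfl⟩)
  have chord : ∀ d ∈ Icc s b, gittinsRank F b * (F s - F d) ≤ tailInt F s - tailInt F d := by
    intro d hd
    have h1 := hF.serptRank_mul s
    have h2 := hF.serptRank_mul d
    have h3 := mul_le_mul_of_nonneg_right (h d hd) (hF.pos d).le
    have h4 := mul_le_mul_of_nonneg_right hb (sub_nonneg.2 (hF.anti hd.1))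
    linarith
  refine hF.le_gittinsRank hb fun e hse => ?_
  rcases le_or_gt e b with heb | heb
  · exact chord e ⟨hse.le, heb⟩
  · have h1 := chord b ⟨hsb, le_rfl⟩
    have h2 := hF.gittinsRank_mul_le heb.le
    linarith

theorem bddAbove_gittinsRank (hF : IsSmoothTail F) (a : ℝ) :
    BddAbove (gittinsRank F '' Icc 0 a) := by
  obtain ⟨C, hC⟩ := isCompact_Icc.bddAbove_image (hF.continuous_serptRank.continuousOn (s := Icc 0 a))
  refine ⟨C, ?_⟩
  rintro _ ⟨b, hb, rfl⟩
  exact (hF.gittinsRank_le_serptRank b).trans (hC ⟨b, hb, rfl⟩)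

theorem isHillAge_serptRank (hF : IsSmoothTail F) {a : ℝ} (h : IsHillAge (gittinsRank F) a) :
    IsHillAge (serptRank F) a := by
  refine ⟨h.1, fun hv => h.2 ?_⟩
  obtain ⟨ha, ε, hε, hc⟩ := hv
  set δ := min a (ε / 2) with hδ
  have hδ0 : 0 < δ := lt_min ha (by positivity)
  have h1 := min_le_left a (ε / 2)
  have h2 := min_le_right a (ε / 2)
  obtain ⟨s, hs, -, he⟩ := exists_incEnvelope_eq hF.continuous_serptRank
    (show 0 ≤ a - δ by linarith)
  have hmax : ∀ t ∈ Ioo (a - δ) (a + δ), ∀ d ∈ Icc 0 t, serptRank F d ≤ serptRank F s := by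
    intro t ht d hd
    obtain ⟨s', -, hmax', he'⟩ := exists_incEnvelope_eq hF.continuous_serptRank
      (show 0 ≤ t by linarith [ht.1])
    rw [← he, hc _ ⟨by linarith, by linarith⟩, ← hc t ⟨by linarith [ht.1], by linarith [ht.2]⟩, he']
    exact hmax' d hd
  have key : ∀ t ∈ Ioo (a - δ) (a + δ),
      incEnvelope (gittinsRank F) t = incEnvelope (gittinsRank F) s := by
    intro t ht
    have hst : s ≤ t := hs.2.trans ht.1.le
    refine le_antisymm (csSup_le ⟨_, s, ⟨hs.1, hst⟩, rfl⟩ ?_)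
      (csSup_le_csSup (hF.bddAbove_gittinsRank t) ⟨_, s, ⟨hs.1, le_rfl⟩, rfl⟩
        (image_mono (Icc_subset_Icc_right hst)))
    rintro _ ⟨b, hb, rfl⟩
    rcases le_or_gt b s with hbs | hbs
    · exact le_csSup (hF.bddAbove_gittinsRank s) ⟨b, ⟨hb.1, hbs⟩, rfl⟩
    · refine (hF.gittinsRank_le_of_serptRank_le hbs.le fun d hd =>
        hmax t ht d ⟨hs.1.trans hd.1, hd.2.trans hb.2⟩).trans
        (le_csSup (hF.bddAbove_gittinsRank s) ⟨s, ⟨hs.1, le_rfl⟩, rfl⟩)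
  refine ⟨ha, δ, hδ0, fun t ht => ?_⟩
  rw [key t ht, key a ⟨by linarith, by linarith⟩]

theorem tailInt_le_of_gittinsRank_lt (hF : IsSmoothTail F) {c : ℝ}
    (h : ∀ t, 0 ≤ t → gittinsRank F t < c) {t : ℝ} (ht : 0 ≤ t) : tailInt F t ≤ c * F t := by
  by_contra! hlt
  set φ : ℝ → ℝ := fun x => tailInt F x - c * F x with hφ
  have hφc : Continuous φ := hF.continuous_tailInt.sub (hF.continuous.const_mul c)
  have hφ0 : Filter.Tendsto φ Filter.atTop (nhds 0) := by
    simpa using hF.tendsto_tailInt.sub (hF.tendsto_zero.const_mul c)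
  have hφt : 0 < φ t := sub_pos.2 hlt
  obtain ⟨N, hN⟩ := Filter.eventually_atTop.1 (hφ0.eventually_lt_const hφt)
  obtain ⟨m, hm, hmax⟩ := isCompact_Icc.exists_isMaxOn (nonempty_Icc.2 (le_max_left t N))
    hφc.continuousOn
  have hmt : φ t ≤ φ m := hmax ⟨le_rfl, le_max_left t N⟩
  have hall : ∀ b, t ≤ b → φ b ≤ φ m := by
    intro b hb
    rcases le_or_gt b (max t N) with hbN | hbN
    · exact hmax ⟨hb, hbN⟩
    · exact (hN b ((le_max_right t N).trans hbN.le)).le.trans hmt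
  have := h m (ht.trans hm.1)
  refine absurd this (not_lt.2 (hF.le_gittinsRank ?_ fun b hb => ?_))
  · rw [serptRank, le_div_iff₀ (hF.pos m)]
    have : 0 < φ m := hφt.trans_le hmt
    exact (sub_pos.1 this).le
  · have := hall b (hm.1.trans hb.le)
    simp only [hφ] at this
    linarith

theorem integrableOn_mul_of_tailInt_le (hF : IsSmoothTail F) {c : ℝ}
    (h : ∀ t, 0 ≤ t → tailInt F t ≤ c * F t) : IntegrableOn (fun t => t * F t) (Ioi 0) := by
  have hcont : Continuous fun t => t * F t := continuous_id.mul hF.continuous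
  have hc : 0 ≤ c := by
    have := (hF.tailInt_pos 0).trans_le (h 0 le_rfl)
    exact (pos_of_mul_pos_left this (hF.pos 0).le).le
  refine integrableOn_Ioi_of_intervalIntegral_norm_bounded (c * tailInt F 0) 0
    (b := id) (fun i => hcont.integrableOn_Ioc) Filter.tendsto_id ?_
  filter_upwards [Filter.eventually_ge_atTop 0] with T hT
  have e1 : ∫ t in (0 : ℝ)..T, ‖t * F t‖ = ∫ t in (0 : ℝ)..T, t * F t := by
    refine intervalIntegral.integral_congr fun t ht => ?_
    rw [uIcc_of_le hT] at ht
    exact Real.norm_of_nonneg (mul_nonneg ht.1 (hF.pos t).le)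
  have e2 : ∫ t in (0 : ℝ)..T, t * F t = -(T * tailInt F T) + ∫ t in (0 : ℝ)..T, tailInt F t := by
    have h1 : ∀ t ∈ uIcc 0 T, HasDerivAt (fun t => -(t * tailInt F t))
        (-(1 * tailInt F t + t * -F t)) t :=
      fun t _ => ((hasDerivAt_id t).mul (hF.hasDerivAt_tailInt t)).neg
    have hci : Continuous fun t => -(1 * tailInt F t + t * -F t) := by
      have := hF.continuous_tailInt
      have := hF.continuous
      fun_prop
    have h2 := intervalIntegral.integral_eq_sub_of_hasDerivAt h1 (hci.intervalIntegrable 0 T)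
    have h3 : ∫ t in (0 : ℝ)..T, -(1 * tailInt F t + t * -F t) =
        (∫ t in (0 : ℝ)..T, t * F t) - ∫ t in (0 : ℝ)..T, tailInt F t := by
      rw [← intervalIntegral.integral_sub (hcont.intervalIntegrable 0 T)
        (hF.continuous_tailInt.intervalIntegrable 0 T)]
      refine intervalIntegral.integral_congr fun t _ => ?_
      ring
    rw [h3] at h2
    simp only [zero_mul, neg_zero, sub_zero] at h2
    linarith
  have e3 : ∫ t in (0 : ℝ)..T, tailInt F t ≤ ∫ t in (0 : ℝ)..T, c * F t :=
    intervalIntegral.integral_mono_on hT (hF.continuous_tailInt.intervalIntegrable 0 T)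
      ((hF.intervalIntegrable 0 T).const_mul c) fun t ht => h t ht.1
  rw [intervalIntegral.integral_const_mul, hF.integral_eq_sub] at e3
  simp only [id]
  rw [e1, e2]
  have := mul_nonneg hT (hF.tailInt_pos T).le
  have := mul_nonneg hc (hF.tailInt_pos T).le
  linarith

/-- An unbounded final valley of the Gittins rank forces a finite second moment. -/
theorem integrableOn_mul_of_nextHillT_top (hF : IsSmoothTail F) {x : ℝ} (hx : 0 < x)
    (h : nextHillT (gittinsRank F) x = ⊤) : IntegrableOn (fun t => t * F t) (Ioi 0) := by
  have hv : ¬ IsHillAge (gittinsRank F) x := by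
    intro hh
    rw [nextHillT_of_isHillAge hh] at h
    exact WithTop.coe_ne_top h
  have hle : ∀ t, 0 ≤ t → gittinsRank F t ≤ incEnvelope (gittinsRank F) x := by
    intro t ht
    have hm : x ≤ max t x := le_max_right t x
    have hpx := prevHill_lt hx hv
    rw [incEnvelope_eq_of_gap (prevHill_nonneg hx) (fun _ => not_isHillAge_of_mem_gap hv)
      (x := x) (y := max t x) ⟨hpx, lt_nextHillT hv⟩
      ⟨hpx.trans_le hm, by rw [h]; exact WithTop.coe_lt_top _⟩]
    exact le_csSup (hF.bddAbove_gittinsRank _) ⟨t, ⟨ht, le_max_left t x⟩, rfl⟩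
  exact hF.integrableOn_mul_of_tailInt_le fun t ht =>
    hF.tailInt_le_of_gittinsRank_lt (c := incEnvelope (gittinsRank F) x + 1)
      (fun t ht => (hle t ht).trans_lt (lt_add_one _)) ht

end IsSmoothTail

end SmoothTail

section ExtendedEndpoints

variable {F : ℝ → ℝ} {lam : ℝ}

/-- The tail function extended by `F(∞) = 0`. -/
noncomputable def tailT (F : ℝ → ℝ) : WithTop ℝ → ℝ := WithTop.recTopCoe 0 F

theorem tailT_top (F : ℝ → ℝ) : tailT F ⊤ = 0 := rfl

theorem tailT_coe (F : ℝ → ℝ) (a : ℝ) : tailT F a = F a := rfl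

theorem loadCompT_top (F : ℝ → ℝ) (lam : ℝ) : loadCompT F lam ⊤ = 1 - lam * tailInt F 0 := rfl

namespace IsSmoothTail

theorem loadCompT_coe (hF : IsSmoothTail F) (lam a : ℝ) :
    loadCompT F lam (a : WithTop ℝ) = 1 - lam * tailInt F 0 + lam * tailInt F a := by
  change 1 - lam * ∫ t in (0 : ℝ)..a, F t = _
  rw [hF.integral_eq_sub]; ring

theorem loadCompT_anti (hF : IsSmoothTail F) (hlam : 0 < lam) : Antitone (loadCompT F lam) := by
  intro a b hab
  induction b using WithTop.recTopCoe with
  | top =>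
    induction a using WithTop.recTopCoe with
    | top => exact le_rfl
    | coe a =>
      rw [loadCompT_top, hF.loadCompT_coe]
      linarith [mul_pos hlam (hF.tailInt_pos a)]
  | coe b =>
    induction a using WithTop.recTopCoe with
    | top => exact absurd hab (not_le.2 (WithTop.coe_lt_top b))
    | coe a =>
      rw [hF.loadCompT_coe, hF.loadCompT_coe]
      have := mul_le_mul_of_nonneg_left
        (hF.strictAnti_tailInt.antitone (WithTop.coe_le_coe.1 hab)) hlam.le
      linarith

theorem le_loadCompT (hF : IsSmoothTail F) (hlam : 0 < lam) (z : WithTop ℝ) :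
    1 - lam * tailInt F 0 ≤ loadCompT F lam z := hF.loadCompT_anti hlam (le_top : z ≤ ⊤)

theorem secMomT_mono (hF : IsSmoothTail F) (hlam : 0 < lam) {x : ℝ} {z w : WithTop ℝ}
    (hx : 0 ≤ x) (hxz : (x : WithTop ℝ) ≤ z) (hzw : z ≤ w)
    (hw : w = ⊤ → IntegrableOn (fun t => t * F t) (Ioi 0)) :
    secMomT F lam z ≤ secMomT F lam w := by
  have hcont : Continuous fun t => t * F t := continuous_id.mul hF.continuous
  have hnn : ∀ t : ℝ, 0 < t → 0 ≤ t * F t := fun t ht => mul_nonneg ht.le (hF.pos t).le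
  induction z using WithTop.recTopCoe with
  | top => rw [top_le_iff.1 hzw]
  | coe z =>
    have hz0 : 0 ≤ z := hx.trans (WithTop.coe_le_coe.1 hxz)
    induction w using WithTop.recTopCoe with
    | top =>
      change lam * ∫ t in (0 : ℝ)..z, t * F t ≤ lam * ∫ t in Ioi (0 : ℝ), t * F t
      rw [intervalIntegral.integral_of_le hz0]
      refine mul_le_mul_of_nonneg_left (setIntegral_mono_set (hw rfl) ?_ ?_) hlam.le
      · exact (ae_restrict_mem measurableSet_Ioi).mono fun t ht => hnn t ht
      · exact (Ioc_subset_Ioi_self).eventuallyLE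
    | coe w =>
      have hzw' : z ≤ w := WithTop.coe_le_coe.1 hzw
      change lam * ∫ t in (0 : ℝ)..z, t * F t ≤ lam * ∫ t in (0 : ℝ)..w, t * F t
      rw [intervalIntegral.integral_of_le hz0, intervalIntegral.integral_of_le (hz0.trans hzw')]
      refine mul_le_mul_of_nonneg_left (setIntegral_mono_set hcont.integrableOn_Ioc ?_ ?_) hlam.le
      · exact (ae_restrict_mem measurableSet_Ioc).mono fun t ht => hnn t ht.1
      · exact (Ioc_subset_Ioc_right hzw').eventuallyLE

theorem secMomT_nonneg (hF : IsSmoothTail F) (hlam : 0 < lam) {x : ℝ} {z : WithTop ℝ}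
    (hx : 0 ≤ x) (hxz : (x : WithTop ℝ) ≤ z) : 0 ≤ secMomT F lam z := by
  have hnn : ∀ t : ℝ, 0 ≤ t → 0 ≤ t * F t := fun t ht => mul_nonneg ht (hF.pos t).le
  induction z using WithTop.recTopCoe with
  | top => exact mul_nonneg hlam.le (setIntegral_nonneg measurableSet_Ioi fun t ht => hnn t ht.le)
  | coe z =>
    exact mul_nonneg hlam.le (intervalIntegral.integral_nonneg
      (hx.trans (WithTop.coe_le_coe.1 hxz)) fun t ht => hnn t ht.1)

theorem tailT_nonneg (hF : IsSmoothTail F) (z : WithTop ℝ) : 0 ≤ tailT F z := by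
  induction z using WithTop.recTopCoe with
  | top => exact le_rfl
  | coe z => exact (hF.pos z).le

theorem tailT_le (hF : IsSmoothTail F) {t : ℝ} {z : WithTop ℝ} (h : (t : WithTop ℝ) ≤ z) :
    tailT F z ≤ F t := by
  induction z using WithTop.recTopCoe with
  | top => exact (hF.pos t).le
  | coe z => exact hF.anti (WithTop.coe_le_coe.1 h)

theorem lintegral_gapSet (hF : IsSmoothTail F) {a : ℝ} {z : WithTop ℝ} (haz : (a : WithTop ℝ) ≤ z)
    {A B C : ℝ} (hA : 0 < A) (hB : 0 ≤ B) (hC : 0 ≤ C) :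
    ∫⁻ t in gapSet a z, ENNReal.ofReal (C * (-deriv F t / (A + B * F t) ^ 2)) =
      ENNReal.ofReal (C * ((F a - tailT F z) / ((A + B * F a) * (A + B * tailT F z)))) := by
  have hpos : ∀ t, 0 < A + B * F t := fun t => by have := mul_nonneg hB (hF.pos t).le; linarith
  have hposT : 0 < A + B * tailT F z := by
    have := mul_nonneg hB (hF.tailT_nonneg z); linarith
  set g : ℝ → ℝ := fun t => C * (-deriv F t / (A + B * F t) ^ 2) with hg
  set Φ : ℝ → ℝ := fun t => -(C / A * (F t / (A + B * F t))) with hΦ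
  have hgnn : ∀ t, 0 ≤ g t := fun t =>
    mul_nonneg hC (div_nonneg (neg_nonneg.2 (hF.deriv_nonpos t)) (sq_nonneg _))
  have hgc : Continuous g := by
    have h1 := hF.continuous
    have h2 := hF.continuous_deriv
    exact continuous_const.mul (h2.neg.div (by fun_prop) fun t => (pow_pos (hpos t) 2).ne')
  have hderiv : ∀ t, HasDerivAt Φ (g t) t := by
    intro t
    have h1 := hF.hasDerivAt t
    have h2 := ((h1.div ((h1.const_mul B).const_add A) (hpos t).ne').const_mul (C / A)).neg
    refine h2.congr_deriv ?_
    simp only [hg]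
    have := (hpos t).ne'
    field_simp
    ring
  have hval : ∀ p : ℝ, A + B * p ≠ 0 → -(C / A * (p / (A + B * p))) - Φ a =
      C * ((F a - p) / ((A + B * F a) * (A + B * p))) := by
    intro p hp
    simp only [hΦ]
    calc _ = C / A * (F a / (A + B * F a) - p / (A + B * p)) := by ring
      _ = C / A * (A * (F a - p) / ((A + B * F a) * (A + B * p))) := by
          rw [div_sub_div _ _ (hpos a).ne' hp]
          congr 2
          ring
      _ = _ := by rw [mul_div_assoc, ← mul_assoc, div_mul_cancel₀ _ hA.ne']
  rw [← hval _ hposT.ne']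
  induction z using WithTop.recTopCoe with
  | top =>
    rw [gapSet_top]
    have hlim : Filter.Tendsto Φ Filter.atTop (nhds (-(C / A * (0 / (A + B * 0))))) := by
      have h1 := hF.tendsto_zero
      exact ((h1.div ((h1.const_mul B).const_add A) (by simpa using hA.ne')).const_mul _).neg
    have hint : IntegrableOn g (Ioi a) :=
      integrableOn_Ioi_deriv_of_nonneg' (fun t _ => hderiv t) (fun t _ => hgnn t) hlim
    rw [← ofReal_integral_eq_lintegral_ofReal hint (Filter.Eventually.of_forall hgnn),
      integral_Ioi_of_hasDerivAt_of_nonneg' (fun t _ => hderiv t) (fun t _ => hgnn t) hlim,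
      tailT_top]
  | coe z =>
    have haz' : a ≤ z := WithTop.coe_le_coe.1 haz
    rw [gapSet_coe, setLIntegral_congr Ioo_ae_eq_Ioc,
      ← ofReal_integral_eq_lintegral_ofReal hgc.integrableOn_Ioc
        (Filter.Eventually.of_forall hgnn), ← intervalIntegral.integral_of_le haz',
      intervalIntegral.integral_eq_sub_of_hasDerivAt (fun t _ => hderiv t)
        (hgc.intervalIntegrable a z), tailT_coe]

theorem lintegral_gapSet_const (hF : IsSmoothTail F) {a : ℝ} {z : WithTop ℝ}
    (haz : (a : WithTop ℝ) ≤ z) {C : ℝ} (hC : 0 ≤ C) :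
    ∫⁻ t in gapSet a z, ENNReal.ofReal (C * -deriv F t) =
      ENNReal.ofReal (C * (F a - tailT F z)) := by
  simpa using hF.lintegral_gapSet haz one_pos le_rfl hC

end IsSmoothTail

end ExtendedEndpoints

section Comparison

variable {F : ℝ → ℝ} {lam : ℝ}

theorem chord_sum_le {s H k B p w q : ℝ} (hs : 0 < s) (hs1 : s ≤ 1) (hB : 0 < B)
    (hH : H = s ^ 2 + B * p) (hk : k = s ^ 2 + B * w) (hH1 : H ≤ 1) (hq : 0 < q) (hqw : q ≤ w)
    (hwp : w ≤ p) :
    (p - w) / (H * k) + (w - q) / (k * k) ≤ 2 / (1 + s) * ((p - q) / (H * k)) := by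
  have hw : 0 < w := hq.trans_le hqw
  have hk0 : 0 < k := by rw [hk]; positivity
  have hp : 0 < p := hw.trans_le hwp
  have hH0 : 0 < H := by rw [hH]; positivity
  have hHs : s ^ 2 ≤ H := by rw [hH]; nlinarith
  have hkH : k ≤ H := by rw [hk, hH]; nlinarith
  have hD : 0 ≤ 2 * k * (H - s ^ 2) - (1 + s) * (2 * H * k - k ^ 2 - s ^ 2 * H) := by
    have h1 : 0 ≤ (1 - H) * (H - s ^ 2) := mul_nonneg (by linarith) (by linarith)
    have h2 : 0 ≤ s ^ 2 * ((1 - H) * (H - s ^ 2)) := mul_nonneg (sq_nonneg s) h1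
    have h3 := sq_nonneg ((1 + s) * k - s * (s + H))
    have h4 : (1 + s) * (2 * k * (H - s ^ 2) - (1 + s) * (2 * H * k - k ^ 2 - s ^ 2 * H)) =
        ((1 + s) * k - s * (s + H)) ^ 2 + s ^ 2 * ((1 - H) * (H - s ^ 2)) := by ring
    by_contra! hneg
    have := mul_neg_of_pos_of_neg (show 0 < 1 + s by linarith) hneg
    linarith
  have hE0 : 0 ≤ 2 * p * k - (1 + s) * ((p - w) * k + w * H) := by
    have h1 : B * (2 * p * k - (1 + s) * ((p - w) * k + w * H)) =
        2 * k * (H - s ^ 2) - (1 + s) * (2 * H * k - k ^ 2 - s ^ 2 * H) := by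
      have e1 : B * p = H - s ^ 2 := by linarith
      have e2 : B * w = k - s ^ 2 := by linarith
      linear_combination (2 * k - (1 + s) * k) * e1 + ((1 + s) * k - (1 + s) * H) * e2
    by_contra! hneg
    have := mul_neg_of_pos_of_neg hB hneg
    linarith
  have hEw : 0 ≤ (1 - s) * ((p - w) * k) :=
    mul_nonneg (by linarith) (mul_nonneg (by linarith) hk0.le)
  have hE : 0 ≤ 2 * (p - q) * k - (1 + s) * ((p - w) * k + (w - q) * H) := by
    have h1 : w * (2 * (p - q) * k - (1 + s) * ((p - w) * k + (w - q) * H)) =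
        (w - q) * (2 * p * k - (1 + s) * ((p - w) * k + w * H)) +
          q * ((1 - s) * ((p - w) * k)) := by ring
    have h2 := mul_nonneg (sub_nonneg.2 hqw) hE0
    have h3 := mul_nonneg hq.le hEw
    by_contra! hneg
    have := mul_neg_of_pos_of_neg hw hneg
    linarith
  have hs' : 0 < 1 + s := by linarith
  rw [← sub_nonneg]
  have : 2 / (1 + s) * ((p - q) / (H * k)) - ((p - w) / (H * k) + (w - q) / (k * k)) =
      (2 * (p - q) * k - (1 + s) * ((p - w) * k + (w - q) * H)) / ((1 + s) * H * k ^ 2) := by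
    field_simp
  rw [this]
  positivity

/-- The waiting-time integrand of a rank function. -/
noncomputable def waitDensity (F : ℝ → ℝ) (lam : ℝ) (r : ℝ → ℝ) (x : ℝ) : ENNReal :=
  ENNReal.ofReal
    (secMomT F lam (nextHillT r x) /
        (loadCompT F lam (prevHill r x) * loadCompT F lam (nextHillT r x)) *
      (-deriv F x))

/-- A lower bound on the load complement along the SERPT hills inside a Gittins valley `(u, v)`. -/
noncomputable def loadFloor (F : ℝ → ℝ) (lam : ℝ) (u : ℝ) (v : WithTop ℝ) (t : ℝ) : ℝ :=
  max (loadCompT F lam v) (1 - lam * tailInt F 0 + lam * serptRank F u * F t)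

/-- An integrand lying between those of the SERPT and Gittins rank functions. -/
noncomputable def floorDensity (F : ℝ → ℝ) (lam : ℝ) (x : ℝ) : ENNReal :=
  ENNReal.ofReal
    (secMomT F lam (nextHillT (gittinsRank F) x) *
      (-deriv F x / loadFloor F lam (prevHill (gittinsRank F) x)
        (nextHillT (gittinsRank F) x) x ^ 2))

namespace IsSmoothTail

theorem loadFloor_pos (hF : IsSmoothTail F) (hlam : 0 < lam) (he : 0 < 1 - lam * tailInt F 0)
    (u : ℝ) (v : WithTop ℝ) (t : ℝ) : 0 < loadFloor F lam u v t :=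
  (he.trans_le (hF.le_loadCompT hlam v)).trans_le (le_max_left _ _)

theorem prevHill_gittins_le_serpt (hF : IsSmoothTail F) {x : ℝ} (hx : 0 < x) :
    prevHill (gittinsRank F) x ≤ prevHill (serptRank F) x :=
  csSup_le_csSup ⟨x, fun _ ha => ha.1.le⟩ ⟨0, hx, isHillAge_zero _⟩
    fun _ ha => ⟨ha.1, hF.isHillAge_serptRank ha.2⟩

theorem nextHillT_serpt_le_gittins (hF : IsSmoothTail F) (x : ℝ) :
    nextHillT (serptRank F) x ≤ nextHillT (gittinsRank F) x := by
  by_cases hv : nextHillT (gittinsRank F) x = ⊤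
  · rw [hv]; exact le_top
  · obtain ⟨v, hv⟩ := WithTop.ne_top_iff_exists.1 hv
    rw [← hv]
    refine nextHillT_le ?_ (hF.isHillAge_serptRank (isHillAge_of_nextHillT_eq hv.symm))
    have := le_nextHillT (gittinsRank F) x
    rwa [← hv, WithTop.coe_le_coe] at this

theorem le_floorDensity (hF : IsSmoothTail F) (hlam : 0 < lam) (he : 0 < 1 - lam * tailInt F 0)
    {x c : ℝ} (hx : 0 < x)
    (hc : loadFloor F lam (prevHill (gittinsRank F) x) (nextHillT (gittinsRank F) x) x ≤ c) :
    ENNReal.ofReal (secMomT F lam (nextHillT (serptRank F) x) * (-deriv F x / c ^ 2)) ≤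
      floorDensity F lam x := by
  have hpos := hF.loadFloor_pos hlam he (prevHill (gittinsRank F) x)
    (nextHillT (gittinsRank F) x) x
  have hd := neg_nonneg.2 (hF.deriv_nonpos x)
  refine ENNReal.ofReal_le_ofReal (mul_le_mul ?_ ?_ (by positivity)
    (hF.secMomT_nonneg hlam hx.le (le_nextHillT _ x)))
  · exact hF.secMomT_mono hlam hx.le (le_nextHillT _ x) (hF.nextHillT_serpt_le_gittins x)
      (hF.integrableOn_mul_of_nextHillT_top hx)
  · gcongr

theorem lintegral_serpt_le_floor (hF : IsSmoothTail F) (hlam : 0 < lam)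
    (he : 0 < 1 - lam * tailInt F 0) :
    ∫⁻ x in Ioi (0 : ℝ), waitDensity F lam (serptRank F) x ≤
      ∫⁻ x in Ioi (0 : ℝ), floorDensity F lam x := by
  refine lintegral_le_of_gaps (r := serptRank F) (fun x hx hxh hxy => ?_) fun x hx hxv => ?_
  · have hfl : loadFloor F lam (prevHill (gittinsRank F) x) (nextHillT (gittinsRank F) x) x ≤
        loadCompT F lam x := by
      refine max_le (hF.loadCompT_anti hlam (le_nextHillT _ x)) ?_
      rw [hF.loadCompT_coe, ← hF.serptRank_mul x, ← mul_assoc]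
      have h1 := le_of_isHillAge hF.continuous_serptRank hxh (prevHill_nonneg hx)
        (prevHill_le (r := gittinsRank F) hx)
      have := hF.pos x
      gcongr
    refine le_trans (le_of_eq ?_) (hF.le_floorDensity hlam he hx hfl)
    rw [waitDensity, hxy, nextHillT_of_isHillAge hxh]
    congr 1
    ring
  · set y := prevHill (serptRank F) x with hy
    set z := nextHillT (serptRank F) x with hz
    have hy0 : 0 ≤ y := prevHill_nonneg hx
    have hyh : IsHillAge (serptRank F) y := isHillAge_prevHill hx
    have hxg : x ∈ gapSet y z := ⟨prevHill_lt hx hxv, lt_nextHillT hxv⟩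
    have hgap : ∀ t ∈ gapSet y z, ¬ IsHillAge (serptRank F) t :=
      fun _ => not_isHillAge_of_mem_gap hxv
    have hyz : (y : WithTop ℝ) ≤ z := (WithTop.coe_lt_coe.2 hxg.1).le.trans hxg.2.le
    have hJ : 0 ≤ secMomT F lam z := hF.secMomT_nonneg hlam hx.le hxg.2.le
    set e := 1 - lam * tailInt F 0 with he_def
    have hyload : e + lam * serptRank F y * F y = loadCompT F lam y := by
      rw [hF.loadCompT_coe, mul_assoc, hF.serptRank_mul]
    have hzload : e + lam * serptRank F y * tailT F z = loadCompT F lam z := by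
      clear_value y
      rcases hzt : z with _ | w
      · change e + lam * serptRank F y * tailT F ⊤ = loadCompT F lam ⊤
        rw [tailT_top, loadCompT_top]; ring
      · change e + lam * serptRank F y * tailT F (w : WithTop ℝ) = loadCompT F lam (w : WithTop ℝ)
        rw [tailT_coe, hF.loadCompT_coe, hy, ← rank_eq_of_gap hF.continuous_serptRank hx hxv hzt,
          mul_assoc, hF.serptRank_mul]
    have hylp : 0 < loadCompT F lam y := he.trans_le (hF.le_loadCompT hlam _)
    have hzlp : 0 < loadCompT F lam z := he.trans_le (hF.le_loadCompT hlam _)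
    have hB : 0 ≤ lam * serptRank F y := mul_nonneg hlam.le (hF.serptRank_pos y).le
    calc ∫⁻ t in gapSet y z, waitDensity F lam (serptRank F) t
        = ∫⁻ t in gapSet y z, ENNReal.ofReal
            (secMomT F lam z / (loadCompT F lam y * loadCompT F lam z) * -deriv F t) := by
          refine setLIntegral_congr_fun (isOpen_gapSet y z).measurableSet fun t ht => ?_
          obtain ⟨h1, h2⟩ := hills_eq_of_gap hgap ht hxg
          simp only [waitDensity, h1, h2, ← hy, ← hz]
      _ = ENNReal.ofReal (secMomT F lam z / (loadCompT F lam y * loadCompT F lam z) *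
            (F y - tailT F z)) :=
          hF.lintegral_gapSet_const hyz (div_nonneg hJ (mul_pos hylp hzlp).le)
      _ = ENNReal.ofReal (secMomT F lam z * ((F y - tailT F z) /
            ((e + lam * serptRank F y * F y) * (e + lam * serptRank F y * tailT F z)))) := by
          rw [hyload, hzload]
          congr 1
          ring
      _ = ∫⁻ t in gapSet y z, ENNReal.ofReal (secMomT F lam z *
            (-deriv F t / (e + lam * serptRank F y * F t) ^ 2)) :=
          (hF.lintegral_gapSet hyz he hB hJ).symm
      _ ≤ ∫⁻ t in gapSet y z, floorDensity F lam t := by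
          refine setLIntegral_mono' (isOpen_gapSet y z).measurableSet fun t ht => ?_
          obtain ⟨h1, h2⟩ := hills_eq_of_gap hgap ht hxg
          have ht0 : 0 < t := hy0.trans_lt ht.1
          have hFt := hF.pos t
          rw [hz, ← h2]
          refine hF.le_floorDensity hlam he ht0 (max_le ?_ ?_)
          · refine (hF.loadCompT_anti hlam (hF.nextHillT_serpt_le_gittins t)).trans ?_
            rw [h2, ← hz, ← hzload]
            have := mul_le_mul_of_nonneg_left (hF.tailT_le ht.2.le) hB
            linarith
          · have h3 := hF.prevHill_gittins_le_serpt ht0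
            rw [h1, ← hy] at h3
            have := le_of_isHillAge hF.continuous_serptRank hyh (prevHill_nonneg ht0) h3
            gcongr

theorem lintegral_floor_gap_le (hF : IsSmoothTail F) (hlam : 0 < lam) {s : ℝ} (hs : 0 < s)
    (hs1 : s ≤ 1) (hse : s ^ 2 = 1 - lam * tailInt F 0) {u : ℝ} {v : WithTop ℝ} (hu0 : 0 ≤ u)
    (huv : (u : WithTop ℝ) < v) (hv : ∀ w : ℝ, v = w → serptRank F u ≤ serptRank F w)
    {J : ℝ} (hJ : 0 ≤ J) :
    ∫⁻ t in gapSet u v, ENNReal.ofReal (J * (-deriv F t / loadFloor F lam u v t ^ 2)) ≤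
      ENNReal.ofReal (2 / (1 + s) *
        (J / (loadCompT F lam u * loadCompT F lam v) * (F u - tailT F v))) := by
  set e := 1 - lam * tailInt F 0 with he_def
  have he : 0 < e := by rw [← hse]; positivity
  have hr := hF.serptRank_pos u
  have hB : 0 < lam * serptRank F u := mul_pos hlam hr
  have hd : ∀ t, 0 ≤ -deriv F t := fun t => neg_nonneg.2 (hF.deriv_nonpos t)
  have huload : loadCompT F lam u = e + lam * serptRank F u * F u := by
    rw [hF.loadCompT_coe, mul_assoc, hF.serptRank_mul]
  have huH : 0 < loadCompT F lam u := he.trans_le (hF.le_loadCompT hlam _)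
  have hline : ∀ t, J * (-deriv F t / loadFloor F lam u v t ^ 2) ≤
      J * (-deriv F t / (e + lam * serptRank F u * F t) ^ 2) := by
    intro t
    have h1 := hd t
    have h2 : 0 < e + lam * serptRank F u * F t := by have := hF.pos t; positivity
    have h3 : e + lam * serptRank F u * F t ≤ loadFloor F lam u v t := le_max_right _ _
    gcongr
  have hflat : ∀ t, J * (-deriv F t / loadFloor F lam u v t ^ 2) ≤
      J * (-deriv F t / (loadCompT F lam v + 0 * F t) ^ 2) := by
    intro t
    have h1 := hd t
    have h2 : 0 < loadCompT F lam v := he.trans_le (hF.le_loadCompT hlam _)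
    have h3 : loadCompT F lam v ≤ loadFloor F lam u v t := le_max_left _ _
    rw [zero_mul, add_zero]
    gcongr
  induction v using WithTop.recTopCoe with
  | top =>
    calc _ ≤ ∫⁻ t in gapSet u ⊤, ENNReal.ofReal
          (J * (-deriv F t / (e + lam * serptRank F u * F t) ^ 2)) :=
          lintegral_mono fun t => ENNReal.ofReal_le_ofReal (hline t)
      _ = ENNReal.ofReal (J * ((F u - tailT F ⊤) / ((e + lam * serptRank F u * F u) *
          (e + lam * serptRank F u * tailT F ⊤)))) := hF.lintegral_gapSet le_top he hB.le hJ
      _ ≤ _ := by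
        rw [tailT_top, loadCompT_top, ← he_def, huload, mul_zero, add_zero, sub_zero]
        refine ENNReal.ofReal_le_ofReal ?_
        rw [huload] at huH
        have h1 : 0 ≤ J * (F u / ((e + lam * serptRank F u * F u) * e)) := by
          have := hF.pos u
          positivity
        have h2 : 1 ≤ 2 / (1 + s) := by rw [le_div_iff₀ (by linarith)]; linarith
        calc _ ≤ 2 / (1 + s) * (J * (F u / ((e + lam * serptRank F u * F u) * e))) :=
              le_mul_of_one_le_left h1 h2
          _ = _ := by ring
  | coe v =>
    have huv' : u < v := WithTop.coe_lt_coe.1 huv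
    have hrv := hv v rfl
    set w := tailInt F v / serptRank F u with hw
    have hwr : serptRank F u * w = tailInt F v := mul_div_cancel₀ _ hr.ne'
    have hFw : F v ≤ w := by
      rw [hw, le_div_iff₀ hr, ← hF.serptRank_mul v, mul_comm]
      exact mul_le_mul_of_nonneg_right hrv (hF.pos v).le
    have hwF : w ≤ F u := by
      rw [hw, div_le_iff₀ hr, mul_comm, hF.serptRank_mul]
      exact hF.strictAnti_tailInt.antitone huv'.le
    obtain ⟨m, hm, hmw⟩ := intermediate_value_Icc' huv'.le hF.continuous.continuousOn ⟨hFw, hwF⟩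
    have hvload : loadCompT F lam (v : WithTop ℝ) = e + lam * serptRank F u * w := by
      rw [hF.loadCompT_coe, mul_assoc, hwr]
    have hvk : 0 < loadCompT F lam (v : WithTop ℝ) := he.trans_le (hF.le_loadCompT hlam _)
    have hH1 : loadCompT F lam (u : WithTop ℝ) ≤ 1 := by
      have := hF.loadCompT_anti hlam (WithTop.coe_le_coe.2 hu0)
      rw [hF.loadCompT_coe lam 0] at this
      simpa using this
    have key := chord_sum_le hs hs1 hB (hse.symm ▸ huload) (hse.symm ▸ hvload) hH1 (hF.pos v) hFw hwF
    have hsub : gapSet u (v : WithTop ℝ) ⊆ Ioc u m ∪ gapSet m (v : WithTop ℝ) := by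
      intro t ht
      rcases le_or_gt t m with h | h
      · exact Or.inl ⟨ht.1, h⟩
      · exact Or.inr ⟨h, ht.2⟩
    calc _ ≤ (∫⁻ t in Ioc u m, ENNReal.ofReal
              (J * (-deriv F t / loadFloor F lam u (v : WithTop ℝ) t ^ 2))) +
            ∫⁻ t in gapSet m (v : WithTop ℝ), ENNReal.ofReal
              (J * (-deriv F t / loadFloor F lam u (v : WithTop ℝ) t ^ 2)) :=
          (lintegral_mono_set hsub).trans (lintegral_union_le _ _ _)
      _ ≤ (∫⁻ t in gapSet u (m : WithTop ℝ), ENNReal.ofReal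
              (J * (-deriv F t / (e + lam * serptRank F u * F t) ^ 2))) +
            ∫⁻ t in gapSet m (v : WithTop ℝ), ENNReal.ofReal
              (J * (-deriv F t / (loadCompT F lam (v : WithTop ℝ) + 0 * F t) ^ 2)) := by
          rw [gapSet_coe u m, ← setLIntegral_congr Ioo_ae_eq_Ioc]
          exact add_le_add (lintegral_mono fun t => ENNReal.ofReal_le_ofReal (hline t))
            (lintegral_mono fun t => ENNReal.ofReal_le_ofReal (hflat t))
      _ = ENNReal.ofReal (J * ((F u - w) / (loadCompT F lam (u : WithTop ℝ) *
              loadCompT F lam (v : WithTop ℝ)))) +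
            ENNReal.ofReal (J * ((w - F v) / (loadCompT F lam (v : WithTop ℝ) *
              loadCompT F lam (v : WithTop ℝ)))) := by
          rw [hF.lintegral_gapSet (WithTop.coe_le_coe.2 hm.1) he hB.le hJ,
            hF.lintegral_gapSet (WithTop.coe_le_coe.2 hm.2) hvk le_rfl hJ, tailT_coe, tailT_coe,
            hmw, ← huload, ← hvload, zero_mul, zero_mul, add_zero]
      _ = ENNReal.ofReal (J * ((F u - w) / (loadCompT F lam (u : WithTop ℝ) *
              loadCompT F lam (v : WithTop ℝ)) + (w - F v) / (loadCompT F lam (v : WithTop ℝ) *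
              loadCompT F lam (v : WithTop ℝ)))) := by
          rw [← ENNReal.ofReal_add, mul_add]
          · exact mul_nonneg hJ (div_nonneg (by linarith) (mul_pos huH hvk).le)
          · exact mul_nonneg hJ (div_nonneg (by linarith) (mul_pos hvk hvk).le)
      _ ≤ _ := by
          refine ENNReal.ofReal_le_ofReal ((mul_le_mul_of_nonneg_left key hJ).trans_eq ?_)
          rw [tailT_coe]
          ring

theorem lintegral_floor_le_gittins (hF : IsSmoothTail F) (hlam : 0 < lam) {s : ℝ} (hs : 0 < s)
    (hs1 : s ≤ 1) (hse : s ^ 2 = 1 - lam * tailInt F 0) :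
    ∫⁻ x in Ioi (0 : ℝ), floorDensity F lam x ≤
      ENNReal.ofReal (2 / (1 + s)) *
        ∫⁻ x in Ioi (0 : ℝ), waitDensity F lam (gittinsRank F) x := by
  have he : 0 < 1 - lam * tailInt F 0 := by rw [← hse]; positivity
  have hc : 1 ≤ 2 / (1 + s) := by rw [le_div_iff₀ (by linarith)]; linarith
  rw [← lintegral_const_mul' _ _ ENNReal.ofReal_ne_top]
  refine lintegral_le_of_gaps (r := gittinsRank F) (fun x hx hxh hxy => ?_) fun x hx hxv => ?_
  · have hxl : 0 < loadCompT F lam x := he.trans_le (hF.le_loadCompT hlam _)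
    have hJ := hF.secMomT_nonneg hlam hx.le (le_refl (x : WithTop ℝ))
    have hd := neg_nonneg.2 (hF.deriv_nonpos x)
    rw [floorDensity, waitDensity, hxy, nextHillT_of_isHillAge hxh]
    refine le_trans ?_ (le_mul_of_one_le_left zero_le (ENNReal.one_le_ofReal.2 hc))
    refine ENNReal.ofReal_le_ofReal ?_
    have h1 : loadCompT F lam x ≤ loadFloor F lam x x x := le_max_left _ _
    calc secMomT F lam x * (-deriv F x / loadFloor F lam x x x ^ 2)
        ≤ secMomT F lam x * (-deriv F x / loadCompT F lam x ^ 2) := by gcongr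
      _ = _ := by ring
  · set u := prevHill (gittinsRank F) x with hu
    set v := nextHillT (gittinsRank F) x with hv
    have hu0 : 0 ≤ u := prevHill_nonneg hx
    have hxg : x ∈ gapSet u v := ⟨prevHill_lt hx hxv, lt_nextHillT hxv⟩
    have hgap : ∀ t ∈ gapSet u v, ¬ IsHillAge (gittinsRank F) t :=
      fun _ => not_isHillAge_of_mem_gap hxv
    have huv : (u : WithTop ℝ) < v := (WithTop.coe_lt_coe.2 hxg.1).trans hxg.2
    have hJ : 0 ≤ secMomT F lam v := hF.secMomT_nonneg hlam hx.le hxg.2.le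
    have hvr : ∀ w : ℝ, v = w → serptRank F u ≤ serptRank F w := by
      intro w hw
      rw [hw, WithTop.coe_lt_coe] at huv
      exact le_of_isHillAge hF.continuous_serptRank
        (hF.isHillAge_serptRank (isHillAge_of_nextHillT_eq hw)) hu0 huv.le
    have hlu : 0 < loadCompT F lam u := he.trans_le (hF.le_loadCompT hlam _)
    have hlv : 0 < loadCompT F lam v := he.trans_le (hF.le_loadCompT hlam _)
    calc ∫⁻ t in gapSet u v, floorDensity F lam t
        = ∫⁻ t in gapSet u v, ENNReal.ofReal
            (secMomT F lam v * (-deriv F t / loadFloor F lam u v t ^ 2)) := by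
          refine setLIntegral_congr_fun (isOpen_gapSet u v).measurableSet fun t ht => ?_
          obtain ⟨h1, h2⟩ := hills_eq_of_gap hgap ht hxg
          simp only [floorDensity, h1, h2, ← hu, ← hv]
      _ ≤ ENNReal.ofReal (2 / (1 + s) * (secMomT F lam v /
            (loadCompT F lam u * loadCompT F lam v) * (F u - tailT F v))) :=
          hF.lintegral_floor_gap_le hlam hs hs1 hse hu0 huv hvr hJ
      _ = ENNReal.ofReal (2 / (1 + s)) * ∫⁻ t in gapSet u v, ENNReal.ofReal
            (secMomT F lam v / (loadCompT F lam u * loadCompT F lam v) * -deriv F t) := by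
          rw [ENNReal.ofReal_mul (by linarith),
            hF.lintegral_gapSet_const huv.le (div_nonneg hJ (mul_pos hlu hlv).le)]
      _ = ∫⁻ t in gapSet u v,
            ENNReal.ofReal (2 / (1 + s)) * waitDensity F lam (gittinsRank F) t := by
          rw [lintegral_const_mul' _ _ ENNReal.ofReal_ne_top]
          congr 1
          refine setLIntegral_congr_fun (isOpen_gapSet u v).measurableSet fun t ht => ?_
          obtain ⟨h1, h2⟩ := hills_eq_of_gap hgap ht hxg
          simp only [waitDensity, h1, h2, ← hu, ← hv]

end IsSmoothTail

end Comparison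

/-- comparison of the M-SERPT and Gittins waiting-time integrals
(as possibly infinite Lebesgue integrals). -/
theorem stmt5
    (F : ℝ → ℝ) (lam rho : ℝ)
    (hF_diff : ContDiff ℝ 1 F)
    (hF_anti : Antitone F)
    (hF_pos : ∀ t, 0 < F t)
    (hF_le_one : ∀ t, F t ≤ 1)
    (hF_int : IntegrableOn F (Ioi 0))
    (hmean_pos : 0 < ∫ t in Ioi (0:ℝ), F t)
    (hlam : 0 < lam)
    (hrho_def : rho = lam * ∫ t in Ioi (0:ℝ), F t)
    (hrho_lt : rho < 1)
    (hhaz_pm : PiecewiseMonotone (fun t => (-deriv F t) / F t))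
    (hserpt_pm : PiecewiseMonotone (serptRank F))
    (hS_lf : LocFinHillValleyDecomp (serptRank F))
    (hG_lf : LocFinHillValleyDecomp (gittinsRank F)) :
    (∫⁻ x in Ioi (0:ℝ),
        ENNReal.ofReal
          (secMomT F lam (nextHillT (serptRank F) x) /
              (loadCompT F lam (prevHill (serptRank F) x) *
                loadCompT F lam (nextHillT (serptRank F) x)) *
            (-deriv F x)))
      ≤ ENNReal.ofReal (2 / (1 + Real.sqrt (1 - rho))) *
        ∫⁻ x in Ioi (0:ℝ),
          ENNReal.ofReal
            (secMomT F lam (nextHillT (gittinsRank F) x) /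
                (loadCompT F lam (prevHill (gittinsRank F) x) *
                  loadCompT F lam (nextHillT (gittinsRank F) x)) *
              (-deriv F x)) := by
  have hF : IsSmoothTail F := ⟨hF_diff, hF_anti, hF_pos, hF_int⟩
  have he : 1 - rho = 1 - lam * tailInt F 0 := by rw [hrho_def, tailInt]
  have hs2 : Real.sqrt (1 - rho) ^ 2 = 1 - lam * tailInt F 0 := by
    rw [Real.sq_sqrt (by linarith), he]
  have hs : 0 < Real.sqrt (1 - rho) := Real.sqrt_pos.2 (by linarith)
  have hs1 : Real.sqrt (1 - rho) ≤ 1 := by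
    rw [Real.sqrt_le_one, hrho_def]
    linarith [mul_pos hlam hmean_pos]
  exact (hF.lintegral_serpt_le_floor hlam (by linarith)).trans
    (hF.lintegral_floor_le_gittins hlam hs hs1 hs2)
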